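/- arXiv:2109.07840 — 6 statements merged into one kernel-verified Lean document; each statement's English description precedes it below -/
import Mathlib

section
/- Let M be a module over ℤ equipped with a symmetric ℤ-valued bilinear form β. Let n ≥ 1 and let v₁, …, vₙ be elements of M such that β(vᵢ, vᵢ) = -2 for every i and β(vᵢ, vⱼ) ≥ 0 for all i ≠ j. Assume that the simple graph on {1, …, n} in which two distinct indices i, j are adjacent if and only if β(vᵢ, vⱼ) > 0 is connected. Then, setting C = v₁ + ⋯ + vₙ, one has β(C, C) ≥ -2; in particular, if β(C, C) < 0 then β(C, C) = -2. -/
/-- A connected configuration of (-2)-classes with pairwise nonnegative pairings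
has square at least -2; in particular a negative square equals -2. -/
theorem stmt_0 {M : Type*} [AddCommGroup M] [Module ℤ M]
    (β : M →ₗ[ℤ] M →ₗ[ℤ] ℤ) (hsymm : ∀ x y, β x y = β y x)
    (n : ℕ) (hn : 1 ≤ n) (v : Fin n → M)
    (hdiag : ∀ i, β (v i) (v i) = -2)
    (hoff : ∀ i j : Fin n, i ≠ j → 0 ≤ β (v i) (v j))
    (hconn : (SimpleGraph.fromRel fun i j : Fin n => 0 < β (v i) (v j)).Connected) :
    -2 ≤ β (∑ i, v i) (∑ i, v i) ∧
      (β (∑ i, v i) (∑ i, v i) < 0 → β (∑ i, v i) (∑ i, v i) = -2) := by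
  classical
  have heven : ∀ s : Finset (Fin n), Even (β (∑ i ∈ s, v i) (∑ i ∈ s, v i)) := by
    intro s
    induction s using Finset.induction_on with
    | empty => simp
    | insert a s ha ih =>
      rw [Finset.sum_insert ha]
      simp only [map_add, LinearMap.add_apply]
      rw [hdiag, hsymm (∑ i ∈ s, v i) (v a)]
      obtain ⟨k, hk⟩ := ih
      rw [hk]
      exact ⟨-1 + β (v a) (∑ i ∈ s, v i) + k, by ring⟩
  have hlow : -2 ≤ β (∑ i, v i) (∑ i, v i) := by
    generalize hG : (SimpleGraph.fromRel fun i j : Fin n => 0 < β (v i) (v j)) = G at hconn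
    have hadj : ∀ i j, G.Adj i j → 1 ≤ β (v i) (v j) := by
      intro i j h
      rw [← hG, SimpleGraph.fromRel_adj] at h
      rcases h.2 with h | h
      · omega
      · rw [hsymm]; omega
    have hc := hconn.card_vert_le_card_edgeSet_add_one
    rw [Nat.card_eq_fintype_card, Nat.card_eq_fintype_card, Fintype.card_fin,
      ← SimpleGraph.edgeFinset_card] at hc
    have hd := G.sum_degrees_eq_twice_card_edges
    have hrow : ∀ i, (G.degree i : ℤ) - 2 ≤ ∑ j, β (v i) (v j) := by
      intro i
      have h1 : (G.degree i : ℤ) = ∑ j, if G.Adj i j then (1 : ℤ) else 0 := by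
        rw [Finset.sum_boole, ← SimpleGraph.card_neighborFinset_eq_degree,
          SimpleGraph.neighborFinset_eq_filter]
      have h2 : (2 : ℤ) = ∑ j, if i = j then (2 : ℤ) else 0 := by simp
      rw [h1]
      conv_lhs => rw [h2]
      rw [← Finset.sum_sub_distrib]
      refine Finset.sum_le_sum fun j _ => ?_
      by_cases hij : i = j
      · subst hij; simp [hdiag]
      · have := hoff i j hij
        by_cases h : G.Adj i j
        · simpa [hij, h] using hadj i j h
        · simpa [hij, h] using this
    have hs := Finset.sum_le_sum (s := Finset.univ) fun i _ => hrow i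
    have he : β (∑ i, v i) (∑ i, v i) = ∑ i, ∑ j, β (v i) (v j) := by
      simp only [map_sum, LinearMap.sum_apply]
      exact Finset.sum_comm
    rw [Finset.sum_sub_distrib, ← Nat.cast_sum, hd] at hs
    simp only [Finset.sum_const, Finset.card_univ, Fintype.card_fin, nsmul_eq_mul] at hs
    rw [he]
    push_cast at hs
    omega
  refine ⟨hlow, fun h => ?_⟩
  obtain ⟨k, hk⟩ := heven Finset.univ
  omega
end

section
/- Let M be a module over ℤ equipped with a symmetric ℤ-valued bilinear form β. Let n ≥ 1 and let v₁, …, vₙ be elements of M such that β(vᵢ, vᵢ) = -2 for every i and β(vᵢ, vⱼ) ≥ 0 for all i ≠ j. If β(v₁ + ⋯ + vₙ, v₁ + ⋯ + vₙ) < -2, then the simple graph on {1, …, n} in which two distinct indices i, j are adjacent if and only if β(vᵢ, vⱼ) > 0 is not connected. -/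
/-- If a configuration of (-2)-classes with pairwise nonnegative pairings has
square less than -2, then its intersection graph is not connected. -/
theorem stmt_1 {M : Type*} [AddCommGroup M] [Module ℤ M]
    (β : M →ₗ[ℤ] M →ₗ[ℤ] ℤ) (hsymm : ∀ x y, β x y = β y x)
    (n : ℕ) (hn : 1 ≤ n) (v : Fin n → M)
    (hdiag : ∀ i, β (v i) (v i) = -2)
    (hoff : ∀ i j : Fin n, i ≠ j → 0 ≤ β (v i) (v j))
    (hlt : β (∑ i, v i) (∑ i, v i) < -2) :
    ¬ (SimpleGraph.fromRel fun i j : Fin n => 0 < β (v i) (v j)).Connected := by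
  classical
  intro hc
  set G := SimpleGraph.fromRel fun i j : Fin n => 0 < β (v i) (v j) with hG
  have h1 := hc.card_vert_le_card_edgeSet_add_one
  rw [Nat.card_eq_fintype_card, Fintype.card_fin, Nat.card_eq_fintype_card,
    ← SimpleGraph.edgeFinset_card] at h1
  have h2 := G.sum_degrees_eq_twice_card_edges
  have h3 : ∀ i, (G.degree i : ℤ) - 2 ≤ ∑ j, β (v i) (v j) := by
    intro i
    have e : (G.degree i : ℤ) - 2
        = ∑ j, ((if G.Adj i j then (1 : ℤ) else 0) + if i = j then -2 else 0) := by
      rw [Finset.sum_add_distrib, Finset.sum_boole, Finset.sum_ite_eq,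
        ← SimpleGraph.card_neighborFinset_eq_degree, SimpleGraph.neighborFinset_eq_filter]
      simp [sub_eq_add_neg]
    rw [e]
    refine Finset.sum_le_sum fun j _ => ?_
    by_cases hij : i = j
    · subst hij
      simp [hdiag]
    · by_cases ha : G.Adj i j
      · have ha' := ha
        rw [hG, SimpleGraph.fromRel_adj, hsymm (v j) (v i), or_self] at ha'
        simp only [ha, hij, if_true, if_false]
        have := ha'.2
        omega
      · simpa [ha, hij] using hoff i j hij
  have h4 : β (∑ i, v i) (∑ i, v i) = ∑ i, ∑ j, β (v i) (v j) := by
    simp only [map_sum, LinearMap.sum_apply]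
    exact Finset.sum_comm
  have h5 := Finset.sum_le_sum fun i (_ : i ∈ Finset.univ) => h3 i
  rw [← h4, Finset.sum_sub_distrib, ← Nat.cast_sum, h2] at h5
  simp only [Finset.sum_const, Finset.card_univ, Fintype.card_fin, nsmul_eq_mul] at h5
  push_cast at h5
  omega
end

section
/- Let M be a module over ℤ equipped with a symmetric ℤ-valued bilinear form β. Let F, P₁, …, Pₘ ∈ M with m ≥ 1, β(F, F) = 0, β(F, Pⱼ) ≥ 1 for all j, β(Pⱼ, Pⱼ) = -2 for all j, and β(Pᵢ, Pⱼ) ≥ 0 for all i ≠ j. Let r ≥ 1 be an integer and set D = r·F + P₁ + ⋯ + Pₘ. Assume β(D, D) = 0. Then there exists an index j with β(D, Pⱼ) < 0, and for every index j one has: β(D, Pⱼ) < 0 if and only if r = 1, β(F, Pⱼ) = 1, and β(Pᵢ, Pⱼ) = 0 for all i ≠ j. -/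
/-- A divisor D = r·F + ΣPⱼ with D² = 0 supported on a fiber class and
horizontal (-2)-classes intersects some Pⱼ negatively, and it does so exactly
when r = 1, F·Pⱼ = 1 and Pⱼ is orthogonal to the other horizontal classes. -/
theorem stmt_4 {M : Type*} [AddCommGroup M] [Module ℤ M]
    (β : M →ₗ[ℤ] M →ₗ[ℤ] ℤ) (hsymm : ∀ x y, β x y = β y x)
    (m : ℕ) (hm : 1 ≤ m) (F : M) (P : Fin m → M)
    (hFF : β F F = 0)
    (hFP : ∀ j, 1 ≤ β F (P j))
    (hPP : ∀ j, β (P j) (P j) = -2)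
    (hPij : ∀ i j : Fin m, i ≠ j → 0 ≤ β (P i) (P j))
    (r : ℤ) (hr : 1 ≤ r) (D : M) (hD : D = r • F + ∑ j, P j)
    (hDD : β D D = 0) :
    (∃ j, β D (P j) < 0) ∧
      ∀ j, (β D (P j) < 0 ↔
        r = 1 ∧ β F (P j) = 1 ∧ ∀ i, i ≠ j → β (P i) (P j) = 0) := by
  have hF : β D F = ∑ j, β F (P j) := by
    rw [hD, map_add, LinearMap.add_apply, map_zsmul, LinearMap.smul_apply, hFF, map_sum,
      LinearMap.sum_apply, smul_zero, zero_add]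
    exact Finset.sum_congr rfl fun j _ => hsymm _ _
  have hP : ∀ j, β D (P j) = r * β F (P j) - 2 + ∑ i ∈ Finset.univ.erase j, β (P i) (P j) := by
    intro j
    rw [hD, map_add, LinearMap.add_apply, map_zsmul, LinearMap.smul_apply, map_sum,
      LinearMap.sum_apply, ← Finset.add_sum_erase _ _ (Finset.mem_univ j), hPP, smul_eq_mul]
    ring
  have hDD' : r * β D F + ∑ j, β D (P j) = 0 := by
    rw [← hDD]
    conv_rhs => rw [show β D D = β D (r • F + ∑ j, P j) by rw [← hD]]
    rw [map_add, map_zsmul, map_sum, smul_eq_mul]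
  have hFpos : 1 ≤ β D F := by
    rw [hF]
    have h1 := Finset.single_le_sum (f := fun j => β F (P j)) (s := Finset.univ)
      (fun j _ => by have := hFP j; show 0 ≤ β F (P j); omega)
      (Finset.mem_univ (⟨0, hm⟩ : Fin m))
    exact (hFP _).trans h1
  refine ⟨?_, fun j => ?_⟩
  · by_contra! h
    have := Finset.sum_nonneg (fun j (_ : j ∈ Finset.univ) => h j)
    nlinarith
  · rw [hP j]
    have hn : ∀ i ∈ Finset.univ.erase j, 0 ≤ β (P i) (P j) := fun i hi =>
      hPij i j (Finset.ne_of_mem_erase hi)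
    have hS := Finset.sum_nonneg hn
    have hf := hFP j
    constructor
    · intro h
      have h1 : r = 1 := by nlinarith
      subst h1
      refine ⟨rfl, by linarith, fun i hi => ?_⟩
      have h0 : ∑ i ∈ Finset.univ.erase j, β (P i) (P j) = 0 := by linarith
      exact (Finset.sum_eq_zero_iff_of_nonneg hn).1 h0 i (by simp [hi])
    · rintro ⟨h1, h2, h3⟩
      rw [Finset.sum_eq_zero fun i hi => h3 i (Finset.ne_of_mem_erase hi), h1, h2]
      norm_num
end

section
/- Let V be a vector space over ℚ equipped with a symmetric bilinear form β. Let n ≥ 1 be an integer, k an integer, and d = n - 1 + 3k. Let D₁ and A₁⁽ʰ⁾, A₂⁽ʰ⁾ for h = 1, …, n-1 be elements of V whose pairings are: β(D₁,D₁) = 6d; β(D₁,Aᵢ⁽ʰ⁾) = 0 for all i,h; β(Aᵢ⁽ʰ⁾,Aᵢ⁽ʰ⁾) = -2; β(A₁⁽ʰ⁾,A₂⁽ʰ⁾) = 1; and β(Aᵢ⁽ʰ⁾,Aⱼ⁽ˡ⁾) = 0 whenever h ≠ l. Define L = (D₁ + Σₕ(A₁⁽ʰ⁾ + 2A₂⁽ʰ⁾))/3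 and M = (2D₁ + Σₕ(2A₁⁽ʰ⁾ + A₂⁽ʰ⁾))/3. Then β(L,L) = 2k, β(M,M) = 2n + 8k - 2, and β(L,M) = n - 1 + 4k. Moreover, if d > 0 and n ≤ 10, then k ≥ -2. -/
/-- Intersection numbers of the triple cover data L, M for a branch locus
consisting of an irreducible curve D₁ with D₁² = 6d and (n-1)
A₂-configurations, together with the bound k ≥ -2. -/
theorem stmt_8 {V : Type*} [AddCommGroup V] [Module ℚ V]
    (β : V →ₗ[ℚ] V →ₗ[ℚ] ℚ) (hsymm : ∀ x y, β x y = β y x)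
    (n : ℕ) (hn : 1 ≤ n) (k d : ℤ) (hd : d = (n:ℤ) - 1 + 3 * k)
    (D1 : V) (A1 A2 : Fin (n - 1) → V)
    (hD1 : β D1 D1 = 6 * (d:ℚ))
    (hD1A1 : ∀ h, β D1 (A1 h) = 0) (hD1A2 : ∀ h, β D1 (A2 h) = 0)
    (hA1A1 : ∀ h, β (A1 h) (A1 h) = -2) (hA2A2 : ∀ h, β (A2 h) (A2 h) = -2)
    (hA12 : ∀ h, β (A1 h) (A2 h) = 1)
    (hA11' : ∀ h l, h ≠ l → β (A1 h) (A1 l) = 0)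
    (hA12' : ∀ h l, h ≠ l → β (A1 h) (A2 l) = 0)
    (hA22' : ∀ h l, h ≠ l → β (A2 h) (A2 l) = 0)
    (L M : V)
    (hL : L = (3⁻¹ : ℚ) • (D1 + ∑ h, (A1 h + (2:ℚ) • A2 h)))
    (hM : M = (3⁻¹ : ℚ) • ((2:ℚ) • D1 + ∑ h, ((2:ℚ) • A1 h + A2 h))) :
    β L L = 2 * (k:ℚ) ∧ β M M = 2 * (n:ℚ) + 8 * (k:ℚ) - 2 ∧
      β L M = (n:ℚ) - 1 + 4 * (k:ℚ) ∧
      (0 < d → n ≤ 10 → -2 ≤ k) := by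
  have key : ∀ (X Y : Fin (n - 1) → V) (c : ℚ), (∀ h, β (X h) (Y h) = c) →
      (∀ h l, h ≠ l → β (X h) (Y l) = 0) → β (∑ h, X h) (∑ h, Y h) = ((n : ℚ) - 1) * c := by
    intro X Y c h1 h2
    have h3 : ∀ h, ∑ l, β (X h) (Y l) = c := by
      intro h
      rw [Finset.sum_eq_single h (fun l _ hl => h2 h l (Ne.symm hl)) (by simp), h1]
    rw [map_sum β, LinearMap.sum_apply]
    simp only [map_sum]
    rw [Finset.sum_congr rfl (fun h _ => h3 h)]
    simp [Nat.cast_sub hn]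
  have k11 := key A1 A1 _ hA1A1 hA11'
  have k12 := key A1 A2 _ hA12 hA12'
  have k22 := key A2 A2 _ hA2A2 hA22'
  have k21 := hsymm (∑ h, A2 h) (∑ h, A1 h)
  rw [k12] at k21
  have d1 : β D1 (∑ h, A1 h) = 0 := by simp [map_sum, hD1A1]
  have d2 : β D1 (∑ h, A2 h) = 0 := by simp [map_sum, hD1A2]
  have d1' := hsymm (∑ h, A1 h) D1
  have d2' := hsymm (∑ h, A2 h) D1
  rw [d1] at d1'
  rw [d2] at d2'
  have hdq : (d : ℚ) = (n : ℚ) - 1 + 3 * k := by rw [hd]; push_cast; ring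
  rw [Finset.sum_add_distrib, ← Finset.smul_sum] at hL hM
  generalize (∑ h, A1 h) = S1 at *
  generalize (∑ h, A2 h) = S2 at *
  subst hL hM
  refine ⟨?_, ?_, ?_, fun _ _ => by omega⟩ <;>
  · simp only [map_add, map_smul, LinearMap.add_apply, LinearMap.smul_apply, smul_eq_mul,
      hD1, k11, k12, k22, k21, d1, d2, d1', d2', hdq]
    ring
end

section
/- In the vector space ℚ¹⁵ with standard basis e₁, …, e₁₅, equip ℚ¹⁵ with the symmetric bilinear form β(x, y) = -2·Σᵢ xᵢyᵢ. Set v₁ = (e₁+e₂+e₃+e₄+e₅+e₆+e₇+e₈)/2, v₂ = (e₁+e₂+e₃+e₄+e₉+e₁₀+e₁₁+e₁₂)/2, v₃ = (e₁+e₂+e₅+e₆+e₉+e₁₀+e₁₃+e₁₄)/2, and v₄ = (e₁+e₃+e₅+e₇+e₉+e₁₁+e₁₃+e₁₅)/2, and let Λ be the ℤ-submodule of ℚ¹⁵ generated by e₁, …, e₁₅, v₁, v₂, v₃, v₄. Then Λ is an even negative definite integral lattice: for all x, y ∈ Λ one has β(x, y) ∈ ℤ, β(x, x) ∈ 2ℤ,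 and β(x, x) < 0 whenever x ≠ 0. -/
noncomputable section

/-- The standard basis of ℚ¹⁵, playing the role of the classes N₁, …, N₁₅. -/
def e15 : Fin 15 → (Fin 15 → ℚ) := fun i => Pi.single i 1

/-- The bilinear form β(x,y) = -2 Σ xᵢyᵢ on ℚ¹⁵. -/
def beta15 (x y : Fin 15 → ℚ) : ℚ := -2 * ∑ i, x i * y i

def v15_1 : Fin 15 → ℚ :=
  (2⁻¹ : ℚ) • (e15 0 + e15 1 + e15 2 + e15 3 + e15 4 + e15 5 + e15 6 + e15 7)
def v15_2 : Fin 15 → ℚ :=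
  (2⁻¹ : ℚ) • (e15 0 + e15 1 + e15 2 + e15 3 + e15 8 + e15 9 + e15 10 + e15 11)
def v15_3 : Fin 15 → ℚ :=
  (2⁻¹ : ℚ) • (e15 0 + e15 1 + e15 4 + e15 5 + e15 8 + e15 9 + e15 12 + e15 13)
def v15_4 : Fin 15 → ℚ :=
  (2⁻¹ : ℚ) • (e15 0 + e15 2 + e15 4 + e15 6 + e15 8 + e15 10 + e15 12 + e15 14)

/-- The overlattice M_{(ℤ/2ℤ)⁴} of A₁^{⊕15}. -/
def Lambda15 : Submodule ℤ (Fin 15 → ℚ) :=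
  Submodule.span ℤ (Set.range e15 ∪ {v15_1, v15_2, v15_3, v15_4})

theorem v1_eq : v15_1 = ![1/2, 1/2, 1/2, 1/2, 1/2, 1/2, 1/2, 1/2, 0, 0, 0, 0, 0, 0, 0] := by
  ext i
  fin_cases i <;> simp [v15_1, e15, Fin.ext_iff]

theorem v2_eq : v15_2 = ![1/2, 1/2, 1/2, 1/2, 0, 0, 0, 0, 1/2, 1/2, 1/2, 1/2, 0, 0, 0] := by
  ext i
  fin_cases i <;> simp [v15_2, e15, Fin.ext_iff]

theorem v3_eq : v15_3 = ![1/2, 1/2, 0, 0, 1/2, 1/2, 0, 0, 1/2, 1/2, 0, 0, 1/2, 1/2, 0] := by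
  ext i
  fin_cases i <;> simp [v15_3, e15, Fin.ext_iff]

theorem v4_eq : v15_4 = ![1/2, 0, 1/2, 0, 1/2, 0, 1/2, 0, 1/2, 0, 1/2, 0, 1/2, 0, 1/2] := by
  ext i
  fin_cases i <;> simp [v15_4, e15, Fin.ext_iff]

theorem b_comm (x y : Fin 15 → ℚ) : beta15 x y = beta15 y x := by
  simp only [beta15, mul_comm]

theorem b_add (x y z : Fin 15 → ℚ) : beta15 (x + y) z = beta15 x z + beta15 y z := by
  simp only [beta15, Pi.add_apply, add_mul, Finset.sum_add_distrib, mul_add]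

theorem b_smul (a : ℤ) (x z : Fin 15 → ℚ) : beta15 (a • x) z = a * beta15 x z := by
  simp only [beta15, Pi.smul_apply, zsmul_eq_mul, mul_assoc, ← Finset.mul_sum]
  ring

theorem b_zero (z : Fin 15 → ℚ) : beta15 0 z = 0 := by
  simp [beta15]

theorem b_e (i : Fin 15) (z : Fin 15 → ℚ) : beta15 (e15 i) z = -2 * z i := by
  simp [beta15, e15, Pi.single_apply]

theorem half_int (i : Fin 15) (y : Fin 15 → ℚ)
    (hy : y ∈ Set.range e15 ∪ {v15_1, v15_2, v15_3, v15_4}) :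
    ∃ a : ℤ, -2 * y i = (a : ℚ) := by
  rcases hy with ⟨j, rfl⟩ | rfl | rfl | rfl | rfl
  · by_cases h : i = j
    · exact ⟨-2, by simp [e15, h]⟩
    · exact ⟨0, by simp [e15, h]⟩
  · rw [v1_eq]
    fin_cases i <;> first | (refine ⟨0, ?_⟩; simp; done) | (refine ⟨-1, ?_⟩; simp; done)
  · rw [v2_eq]
    fin_cases i <;> first | (refine ⟨0, ?_⟩; simp; done) | (refine ⟨-1, ?_⟩; simp; done)
  · rw [v3_eq]
    fin_cases i <;> first | (refine ⟨0, ?_⟩; simp; done) | (refine ⟨-1, ?_⟩; simp; done)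
  · rw [v4_eq]
    fin_cases i <;> first | (refine ⟨0, ?_⟩; simp; done) | (refine ⟨-1, ?_⟩; simp; done)

theorem gen_int (x y : Fin 15 → ℚ)
    (hx : x ∈ Set.range e15 ∪ {v15_1, v15_2, v15_3, v15_4})
    (hy : y ∈ Set.range e15 ∪ {v15_1, v15_2, v15_3, v15_4}) :
    ∃ a : ℤ, beta15 x y = (a : ℚ) := by
  rcases hx with ⟨i, rfl⟩ | hx
  · rw [b_e]
    exact half_int i y hy
  rcases hy with ⟨i, rfl⟩ | hy
  · rw [b_comm, b_e]
    exact half_int i x (Or.inr hx)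
  rcases hx with rfl | rfl | rfl | rfl <;> rcases hy with rfl | rfl | rfl | rfl <;>
    simp only [v1_eq, v2_eq, v3_eq, v4_eq] <;>
    first
    | (refine ⟨-2, ?_⟩; simp [beta15, Fin.sum_univ_succ]; norm_num; done)
    | (refine ⟨-4, ?_⟩; simp [beta15, Fin.sum_univ_succ]; norm_num; done)

theorem gen_even (x : Fin 15 → ℚ)
    (hx : x ∈ Set.range e15 ∪ {v15_1, v15_2, v15_3, v15_4}) :
    ∃ a : ℤ, beta15 x x = 2 * (a : ℚ) := by
  rcases hx with ⟨i, rfl⟩ | hx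
  · exact ⟨-1, by rw [b_e]; simp [e15]⟩
  rcases hx with rfl | rfl | rfl | rfl <;>
    simp only [v1_eq, v2_eq, v3_eq, v4_eq] <;>
    exact ⟨-2, by simp [beta15, Fin.sum_univ_succ]; norm_num⟩

theorem span_int (x y : Fin 15 → ℚ) (hx : x ∈ Lambda15) (hy : y ∈ Lambda15) :
    ∃ a : ℤ, beta15 x y = (a : ℚ) := by
  induction hx using Submodule.span_induction with
  | zero => exact ⟨0, by simp [b_zero]⟩
  | add u v _ _ hu hv =>
    obtain ⟨a, ha⟩ := hu
    obtain ⟨b, hb⟩ := hv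
    exact ⟨a + b, by rw [b_add, ha, hb]; push_cast; ring⟩
  | smul c u _ hu =>
    obtain ⟨a, ha⟩ := hu
    exact ⟨c * a, by rw [b_smul, ha]; push_cast; ring⟩
  | mem u hu =>
    rw [b_comm]
    induction hy using Submodule.span_induction with
    | zero => exact ⟨0, by simp [b_zero]⟩
    | add w v _ _ hw hv =>
      obtain ⟨a, ha⟩ := hw
      obtain ⟨b, hb⟩ := hv
      exact ⟨a + b, by rw [b_add, ha, hb]; push_cast; ring⟩
    | smul c w _ hw =>
      obtain ⟨a, ha⟩ := hw
      exact ⟨c * a, by rw [b_smul, ha]; push_cast; ring⟩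
    | mem w hw => exact gen_int w u hw hu

theorem span_even (x : Fin 15 → ℚ) (hx : x ∈ Lambda15) :
    ∃ a : ℤ, beta15 x x = 2 * (a : ℚ) := by
  induction hx using Submodule.span_induction with
  | zero => exact ⟨0, by simp [b_zero]⟩
  | add u v hu' hv' hu hv =>
    obtain ⟨a, ha⟩ := hu
    obtain ⟨b, hb⟩ := hv
    obtain ⟨c, hc⟩ := span_int u v hu' hv'
    refine ⟨a + b + c, ?_⟩
    rw [b_add, b_comm u, b_comm v, b_add, b_add, b_comm v u, ha, hb, hc]
    push_cast
    ring
  | smul c u _ hu =>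
    obtain ⟨a, ha⟩ := hu
    refine ⟨c * c * a, ?_⟩
    rw [b_smul, b_comm, b_smul, ha]
    push_cast
    ring
  | mem u hu => exact gen_even u hu

/-- The lattice M_{(ℤ/2ℤ)⁴} is an even negative definite integral lattice. -/
theorem stmt_9 :
    ∀ x ∈ Lambda15, ∀ y ∈ Lambda15,
      (∃ a : ℤ, beta15 x y = (a : ℚ)) ∧
      (∃ b : ℤ, beta15 x x = 2 * (b : ℚ)) ∧
      (x ≠ 0 → beta15 x x < 0) := by
  intro x hx y hy
  refine ⟨span_int x y hx hy, span_even x hx, fun h => ?_⟩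
  obtain ⟨i, hi⟩ := Function.ne_iff.mp h
  have hp : 0 < ∑ i, x i * x i :=
    Finset.sum_pos' (fun j _ => mul_self_nonneg _) ⟨i, Finset.mem_univ i, mul_self_pos.mpr hi⟩
  unfold beta15
  linarith

end
end

section
/- In the vector space ℚ¹⁶ with standard basis e₀, e₁, …, e₁₅, equip ℚ¹⁶ with the symmetric bilinear form β(x, y) = 6·x₀y₀ - 2·Σ_{i=1}^{15} xᵢyᵢ. Set v₁ = (e₁+⋯+e₈)/2, v₂ = (e₁+e₂+e₃+e₄+e₉+e₁₀+e₁₁+e₁₂)/2, v₃ = (e₁+e₂+e₅+e₆+e₉+e₁₀+e₁₃+e₁₄)/2, v₄ = (e₁+e₃+e₅+e₇+e₉+e₁₁+e₁₃+e₁₅)/2, and w = (e₀+e₁+⋯+e₁₅)/2, and let Λ be the ℤ-submodule of ℚ¹⁶ generated by e₀, e₁, …, e₁₅, v₁, v₂, v₃, v₄, and w. Then Λ is an even integral lattice: for all x, y ∈ Λ one has β(x, y) ∈ ℤ and β(x, x) ∈ 2ℤ. -/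
noncomputable section

/-- The standard basis of ℚ¹⁶: e₀ plays the role of H, and e₁, …, e₁₅ of
the classes N₁, …, N₁₅. -/
def e16 : Fin 16 → (Fin 16 → ℚ) := fun i => Pi.single i 1

/-- The bilinear form β(x,y) = 6 x₀y₀ - 2 Σ_{i=1}^{15} xᵢyᵢ on ℚ¹⁶. -/
def beta16 (x y : Fin 16 → ℚ) : ℚ :=
  6 * x 0 * y 0 - 2 * ∑ i : Fin 15, x i.succ * y i.succ

def v16_1 : Fin 16 → ℚ :=
  (2⁻¹ : ℚ) • (e16 1 + e16 2 + e16 3 + e16 4 + e16 5 + e16 6 + e16 7 + e16 8)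
def v16_2 : Fin 16 → ℚ :=
  (2⁻¹ : ℚ) • (e16 1 + e16 2 + e16 3 + e16 4 + e16 9 + e16 10 + e16 11 + e16 12)
def v16_3 : Fin 16 → ℚ :=
  (2⁻¹ : ℚ) • (e16 1 + e16 2 + e16 5 + e16 6 + e16 9 + e16 10 + e16 13 + e16 14)
def v16_4 : Fin 16 → ℚ :=
  (2⁻¹ : ℚ) • (e16 1 + e16 3 + e16 5 + e16 7 + e16 9 + e16 11 + e16 13 + e16 15)
def w16 : Fin 16 → ℚ := (2⁻¹ : ℚ) • (∑ i : Fin 16, e16 i)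

/-- The rank-16 lattice R'₁₆. -/
def Lambda16 : Submodule ℤ (Fin 16 → ℚ) :=
  Submodule.span ℤ (Set.range e16 ∪ {v16_1, v16_2, v16_3, v16_4, w16})

lemma beta16_add_right (x y z : Fin 16 → ℚ) : beta16 x (y + z) = beta16 x y + beta16 x z := by
  simp only [beta16, Pi.add_apply, mul_add, Finset.sum_add_distrib]; ring

lemma beta16_comm (x y : Fin 16 → ℚ) : beta16 x y = beta16 y x := by
  simp only [beta16, mul_comm (x _) (y _)]
  ring

lemma beta16_smul_right (c : ℤ) (x y : Fin 16 → ℚ) : beta16 x (c • y) = c * beta16 x y := by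
  simp only [beta16, Pi.smul_apply, zsmul_eq_mul, mul_sub, Finset.mul_sum]
  congr 1
  · ring
  · exact Finset.sum_congr rfl fun i _ => by ring

lemma beta16_zero_right (x : Fin 16 → ℚ) : beta16 x 0 = 0 := by
  simp [beta16]

def gen16 : Set (Fin 16 → ℚ) := Set.range e16 ∪ {v16_1, v16_2, v16_3, v16_4, w16}

def num16 : Fin 21 → Fin 16 → ℤ := fun k i =>
  if k.val < 16 then (if k.val = i.val then 2 else 0)
  else if k.val = 16 then ![0,1,1,1,1,1,1,1,1,0,0,0,0,0,0,0] i
  else if k.val = 17 then ![0,1,1,1,1,0,0,0,0,1,1,1,1,0,0,0] i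
  else if k.val = 18 then ![0,1,1,0,0,1,1,0,0,1,1,0,0,1,1,0] i
  else if k.val = 19 then ![0,1,0,1,0,1,0,1,0,1,0,1,0,1,0,1] i
  else 1

def ib16 (x y : Fin 16 → ℤ) : ℤ := 6 * x 0 * y 0 - 2 * ∑ i : Fin 15, x i.succ * y i.succ

set_option maxRecDepth 100000 in
lemma ib16_dvd : ∀ k l : Fin 21, ib16 (num16 k) (num16 l) % 4 = 0 := by decide +kernel

set_option maxRecDepth 100000 in
lemma ib16_dvd_self : ∀ k : Fin 21, ib16 (num16 k) (num16 k) % 8 = 0 := by decide +kernel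

lemma gen16_num (x : Fin 16 → ℚ) (hx : x ∈ gen16) : ∃ k, ∀ i, x i = (num16 k i : ℚ) / 2 := by
  rcases hx with ⟨j, rfl⟩ | rfl | rfl | rfl | rfl | rfl
  · refine ⟨⟨j.val, by omega⟩, fun i => ?_⟩
    by_cases h : j = i
    · subst h; simp [e16, num16]
    · have h2 : j.val ≠ i.val := fun h' => h (Fin.ext h')
      simp [e16, num16, h2, Pi.single_apply, Ne.symm h]
  · refine ⟨16, fun i => ?_⟩
    fin_cases i <;> simp [v16_1, e16, num16, Pi.single_apply]
  · refine ⟨17, fun i => ?_⟩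
    fin_cases i <;> simp [v16_2, e16, num16, Pi.single_apply]
  · refine ⟨18, fun i => ?_⟩
    fin_cases i <;> simp [v16_3, e16, num16, Pi.single_apply]
  · refine ⟨19, fun i => ?_⟩
    fin_cases i <;> simp [v16_4, e16, num16, Pi.single_apply]
  · refine ⟨20, fun i => ?_⟩
    simp [w16, e16, num16, Finset.sum_apply, Pi.single_apply]

lemma beta16_num (x y : Fin 16 → ℚ) (a b : Fin 16 → ℤ) (hx : ∀ i, x i = (a i : ℚ) / 2)
    (hy : ∀ i, y i = (b i : ℚ) / 2) : beta16 x y = (ib16 a b : ℚ) / 4 := by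
  simp only [beta16, ib16, hx, hy]
  push_cast
  have : ∀ i : Fin 15, (a i.succ : ℚ) / 2 * (b i.succ / 2) = (a i.succ * b i.succ) / 4 :=
    fun i => by ring
  simp only [this, ← Finset.sum_div]
  ring

lemma gen16_int (x y : Fin 16 → ℚ) (hx : x ∈ gen16) (hy : y ∈ gen16) :
    ∃ a : ℤ, beta16 x y = (a : ℚ) := by
  obtain ⟨k, hk⟩ := gen16_num x hx
  obtain ⟨l, hl⟩ := gen16_num y hy
  obtain ⟨c, hc⟩ := Int.dvd_of_emod_eq_zero (ib16_dvd k l)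
  refine ⟨c, ?_⟩
  rw [beta16_num x y _ _ hk hl, hc]
  push_cast; ring

lemma span16_int_left (x y : Fin 16 → ℚ) (hx : x ∈ gen16) (hy : y ∈ Lambda16) :
    ∃ a : ℤ, beta16 x y = (a : ℚ) := by
  refine Submodule.span_induction (p := fun y _ => ∃ a : ℤ, beta16 x y = (a : ℚ)) ?_ ?_ ?_ ?_ hy
  · exact fun y hy => gen16_int x y hx hy
  · exact ⟨0, by simp [beta16_zero_right]⟩
  · rintro y z _ _ ⟨a, ha⟩ ⟨b, hb⟩
    exact ⟨a + b, by rw [beta16_add_right, ha, hb]; push_cast; ring⟩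
  · rintro c y _ ⟨a, ha⟩
    exact ⟨c * a, by rw [beta16_smul_right, ha]; push_cast; ring⟩

lemma span16_int (x y : Fin 16 → ℚ) (hx : x ∈ Lambda16) (hy : y ∈ Lambda16) :
    ∃ a : ℤ, beta16 x y = (a : ℚ) := by
  refine Submodule.span_induction (p := fun y _ => ∃ a : ℤ, beta16 x y = (a : ℚ)) ?_ ?_ ?_ ?_ hy
  · intro y hy
    rw [beta16_comm]
    exact span16_int_left y x hy hx
  · exact ⟨0, by simp [beta16_zero_right]⟩
  · rintro y z _ _ ⟨a, ha⟩ ⟨b, hb⟩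
    exact ⟨a + b, by rw [beta16_add_right, ha, hb]; push_cast; ring⟩
  · rintro c y _ ⟨a, ha⟩
    exact ⟨c * a, by rw [beta16_smul_right, ha]; push_cast; ring⟩

lemma span16_even (x : Fin 16 → ℚ) (hx : x ∈ Lambda16) :
    ∃ b : ℤ, beta16 x x = 2 * (b : ℚ) := by
  refine Submodule.span_induction (p := fun x _ => ∃ b : ℤ, beta16 x x = 2 * (b : ℚ)) ?_ ?_ ?_ ?_ hx
  · intro x hx
    obtain ⟨k, hk⟩ := gen16_num x hx
    obtain ⟨c, hc⟩ := Int.dvd_of_emod_eq_zero (ib16_dvd_self k)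
    refine ⟨c, ?_⟩
    rw [beta16_num x x _ _ hk hk, hc]
    push_cast; ring
  · exact ⟨0, by simp [beta16_zero_right]⟩
  · rintro y z hy hz ⟨a, ha⟩ ⟨b, hb⟩
    obtain ⟨c, hc⟩ := span16_int y z hy hz
    refine ⟨a + b + c, ?_⟩
    rw [beta16_add_right, beta16_comm (y + z) y, beta16_comm (y + z) z, beta16_add_right,
      beta16_add_right, beta16_comm z y, ha, hb, hc]
    push_cast; ring
  · rintro c y _ ⟨a, ha⟩
    refine ⟨c * c * a, ?_⟩
    rw [beta16_smul_right, beta16_comm, beta16_smul_right, ha]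
    push_cast; ring

/-- The lattice R'₁₆ is an even integral lattice. -/
theorem stmt_10 :
    ∀ x ∈ Lambda16, ∀ y ∈ Lambda16,
      (∃ a : ℤ, beta16 x y = (a : ℚ)) ∧
      (∃ b : ℤ, beta16 x x = 2 * (b : ℚ)) := by
  exact fun x hx y hy => ⟨span16_int x y hx hy, span16_even x hx⟩

end
end
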